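/- One has 40.831 ≤ S₂ ≤ 41.227, 0.107 ≤ S₃ ≤ 0.120, and 6.961 ≤ S₄ ≤ 7.018; consequently √(3/2)·S₄ > (1 − √(2/3))·S₂ + S₃, and in fact S₁ − S₂ − S₃ > 0.819. (The numerical verification in Section 4 completing the proof of Lemma 3.4.) -/

import Mathlib

open Finset

/-- The weights `ω_k = (2k choose k)/4^k`. -/
noncomputable def ω : ℕ → ℝ :=
  fun k => (Nat.choose (2 * k) k : ℝ) / 4 ^ k

/-- Maclaurin coefficients of `F(z) = (1 - √(2/3) z)^(-5/2)`. -/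
noncomputable def a : ℕ → ℝ :=
  fun j => ∏ t ∈ Finset.Icc 1 j, (Real.sqrt (2 / 3) * (1 + 3 / (2 * (t : ℝ))))

noncomputable def S₁ : ℝ :=
  Real.sqrt (2 / 3) * ∑ j ∈ Finset.range 25, (1 + 3 / (2 * ((j : ℝ) + 1))) * (a j) ^ 2 * ω (j + 1)

noncomputable def S₂ : ℝ :=
  ∑ j ∈ Finset.range 25, (a j) ^ 2 * ω (j + 1)

noncomputable def S₃ : ℝ :=
  (5 - Real.sqrt 6) * (a 25) ^ 2 * ω 26

noncomputable def S₄ : ℝ :=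
  ∑ j ∈ Finset.range 25, (a j) ^ 2 * ω (j + 1) / ((j : ℝ) + 1)

/-- rational version of `a_j^2 ω_{j+1}` -/
def qT : ℕ → ℚ
  | 0 => 1 / 2
  | (j + 1) => qT j * (2 / 3 * (1 + 3 / (2 * ((j : ℚ) + 1))) ^ 2 * ((2 * (j : ℚ) + 3) / (2 * (j : ℚ) + 4)))

theorem omega_succ' (k : ℕ) : ω (k + 1) = ω k * ((2 * (k : ℝ) + 1) / (2 * (k : ℝ) + 2)) := by
  have h := Nat.succ_mul_centralBinom_succ k
  unfold Nat.centralBinom at h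
  have h' : ((k : ℝ) + 1) * (Nat.choose (2 * (k + 1)) (k + 1) : ℝ)
      = 2 * (2 * (k : ℝ) + 1) * (Nat.choose (2 * k) k : ℝ) := by exact_mod_cast h
  unfold ω
  have hk : (k : ℝ) + 1 ≠ 0 := by positivity
  have e : (Nat.choose (2 * (k + 1)) (k + 1) : ℝ)
      = 2 * (2 * (k : ℝ) + 1) * (Nat.choose (2 * k) k : ℝ) / ((k : ℝ) + 1) := by
    rw [eq_div_iff hk]; linarith
  simp only [e]
  have h2 : 2 * (k : ℝ) + 2 ≠ 0 := by positivity
  rw [pow_succ]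
  field_simp
  ring

theorem a_succ' (j : ℕ) : a (j + 1) = a j * (Real.sqrt (2 / 3) * (1 + 3 / (2 * ((j : ℝ) + 1)))) := by
  unfold a
  rw [Finset.prod_Icc_succ_top (by omega)]
  push_cast
  rfl

theorem term_eq (j : ℕ) : (a j) ^ 2 * ω (j + 1) = ((qT j : ℚ) : ℝ) := by
  induction j with
  | zero => norm_num [a, ω, qT]
  | succ j ih =>
    have hs : Real.sqrt (2 / 3) ^ 2 = 2 / 3 := Real.sq_sqrt (by norm_num)
    rw [a_succ', omega_succ' (j + 1), qT]
    push_cast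
    rw [← ih, mul_pow, mul_pow, hs]
    have : 2 * ((j : ℝ) + 1) + 1 = 2 * j + 3 := by ring
    rw [this]
    have : 2 * ((j : ℝ) + 1) + 2 = 2 * j + 4 := by ring
    rw [this]
    ring

theorem S₂_eq : S₂ = ((∑ j ∈ Finset.range 25, qT j : ℚ) : ℝ) := by
  unfold S₂
  push_cast
  exact Finset.sum_congr rfl fun j _ => term_eq j

theorem S₄_eq : S₄ = ((∑ j ∈ Finset.range 25, qT j / ((j : ℚ) + 1) : ℚ) : ℝ) := by
  unfold S₄
  push_cast
  exact Finset.sum_congr rfl fun j _ => by rw [term_eq j]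

theorem S₁_eq : S₁ = Real.sqrt (2 / 3) * (S₂ + 3 / 2 * S₄) := by
  unfold S₁ S₂ S₄
  rw [Finset.mul_sum (s := Finset.range 25) (a := (3 / 2 : ℝ)), ← Finset.sum_add_distrib]
  congr 1
  refine Finset.sum_congr rfl fun j _ => ?_
  have : (j : ℝ) + 1 ≠ 0 := by positivity
  field_simp

theorem q2 : (41.038 : ℚ) ≤ ∑ j ∈ Finset.range 25, qT j ∧ ∑ j ∈ Finset.range 25, qT j ≤ (41.039 : ℚ) := by
  decide +kernel

theorem q4 : (6.990 : ℚ) ≤ ∑ j ∈ Finset.range 25, qT j / ((j : ℚ) + 1) ∧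
    ∑ j ∈ Finset.range 25, qT j / ((j : ℚ) + 1) ≤ (6.991 : ℚ) := by
  decide +kernel

theorem q3 : (0.0446 : ℚ) ≤ qT 25 ∧ qT 25 ≤ (0.0447 : ℚ) := by
  decide +kernel

/-- The numerical verification of Section 4 completing the proof of Lemma 3.4. -/
theorem numerical_verification :
    (40.831 ≤ S₂ ∧ S₂ ≤ 41.227) ∧
    (0.107 ≤ S₃ ∧ S₃ ≤ 0.120) ∧
    (6.961 ≤ S₄ ∧ S₄ ≤ 7.018) ∧
    Real.sqrt (3 / 2) * S₄ > (1 - Real.sqrt (2 / 3)) * S₂ + S₃ ∧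
    S₁ - S₂ - S₃ > 0.819 := by
  have h2 : (41.038 : ℝ) ≤ S₂ ∧ S₂ ≤ 41.039 := by
    rw [S₂_eq]
    exact ⟨by have := (Rat.cast_le (K := ℝ)).2 q2.1; norm_num at this ⊢; exact this,
      by have := (Rat.cast_le (K := ℝ)).2 q2.2; norm_num at this ⊢; exact this⟩
  have h4 : (6.990 : ℝ) ≤ S₄ ∧ S₄ ≤ 6.991 := by
    rw [S₄_eq]
    exact ⟨by have := (Rat.cast_le (K := ℝ)).2 q4.1; norm_num at this ⊢; exact this,
      by have := (Rat.cast_le (K := ℝ)).2 q4.2; norm_num at this ⊢; exact this⟩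
  have h3 : (0.0446 : ℝ) ≤ (qT 25 : ℝ) ∧ (qT 25 : ℝ) ≤ 0.0447 :=
    ⟨by have := (Rat.cast_le (K := ℝ)).2 q3.1; norm_num at this ⊢; exact this,
      by have := (Rat.cast_le (K := ℝ)).2 q3.2; norm_num at this ⊢; exact this⟩
  have e3 : S₃ = (5 - Real.sqrt 6) * (qT 25 : ℝ) := by
    rw [← term_eq]; unfold S₃; ring
  have r6l : (2.449 : ℝ) ≤ Real.sqrt 6 := Real.le_sqrt_of_sq_le (by norm_num)
  have r6u : Real.sqrt 6 ≤ (2.45 : ℝ) := Real.sqrt_le_iff.2 (by norm_num)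
  have rl : (0.8164 : ℝ) ≤ Real.sqrt (2 / 3) := Real.le_sqrt_of_sq_le (by norm_num)
  have r32 : Real.sqrt (3 / 2) = 3 / 2 * Real.sqrt (2 / 3) := by
    rw [Real.sqrt_eq_iff_mul_self_eq (by norm_num) (by positivity)]
    have := Real.mul_self_sqrt (show (0 : ℝ) ≤ 2 / 3 by norm_num)
    linear_combination (-9 / 4) * this
  have s3l : (0.107 : ℝ) ≤ S₃ := by rw [e3]; nlinarith
  have s3u : S₃ ≤ (0.115 : ℝ) := by rw [e3]; nlinarith
  have key : (0.8164 : ℝ) * (S₂ + 3 / 2 * S₄) ≤ Real.sqrt (2 / 3) * (S₂ + 3 / 2 * S₄) :=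
    mul_le_mul_of_nonneg_right rl (by linarith)
  have fin1 : S₁ - S₂ - S₃ > 0.819 := by rw [S₁_eq]; linarith
  refine ⟨⟨by linarith, by linarith⟩, ⟨s3l, by linarith⟩, ⟨by linarith, by linarith⟩, ?_, fin1⟩
  rw [r32]
  linarith
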